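/- Under the disjoint-support setup, assume that for every u ∈ (0,1) the supremum defining φ(u) is attained at some P(u) ≤ a and Q(u) ≥ b with P(u) < F_η⁻¹(u) < Q(u). Then φ is nonincreasing and Lipschitz with constant 1: for all 0 < u < û < 1, φ(u) ≥ φ(û) ≥ φ(u) + (u − û). -/

import Mathlib

open Set MeasureTheory ProbabilityTheory
open scoped ENNReal Classical

noncomputable section

/-- C_ζ(x) = ∫ (y − x)⁺ ζ(dy). -/
def Cfun (ζ : Measure ℝ) (x : ℝ) : ℝ := ∫ y, max (y - x) 0 ∂ζ

/-- D(x) = C_γ(x) − C_η(x). -/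
def Dfun (η γ : Measure ℝ) (x : ℝ) : ℝ := Cfun γ x - Cfun η x

/-- Left-continuous quantile function F_η⁻¹(u) = inf {x : F_η(x) ≥ u}. -/
def Finv (η : Measure ℝ) (u : ℝ) : ℝ := sInf {x : ℝ | u ≤ (η (Iic x)).toReal}

/-- ℰ_u(x) = D(F_η⁻¹(u)) + (x − F_η⁻¹(u))(γ_a − u) − D(x), where γ_a = γ((−∞,a]). -/
def Efun (η γ : Measure ℝ) (a u x : ℝ) : ℝ :=
  Dfun η γ (Finv η u) + (x - Finv η u) * ((γ (Iic a)).toReal - u) - Dfun η γ x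

/-- φ(u) = sup over p̂ ≤ a, q̂ ≥ b with p̂ < F_η⁻¹(u) < q̂ of (ℰ_u(q̂) − D(p̂))/(q̂ − p̂). -/
def phiFn (η γ : Measure ℝ) (a b u : ℝ) : ℝ :=
  sSup {r : ℝ | ∃ pp qq : ℝ, pp ≤ a ∧ b ≤ qq ∧ pp < Finv η u ∧ Finv η u < qq ∧
    r = (Efun η γ a u qq - Dfun η γ pp) / (qq - pp)}

/-- ζ(u) = γ_a − u − φ(u). -/
def zetaFn (η γ : Measure ℝ) (a b u : ℝ) : ℝ :=
  (γ (Iic a)).toReal - u - phiFn η γ a b u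

/-- The attainment hypothesis: for u ∈ (0,1) the supremum defining φ(u) is attained at
P(u) ≤ a and Q(u) ≥ b with P(u) < F_η⁻¹(u) < Q(u). -/
def AttainsSup (η γ : Measure ℝ) (a b : ℝ) (P Q : ℝ → ℝ) : Prop :=
  ∀ u ∈ Ioo (0 : ℝ) 1,
    P u ≤ a ∧ b ≤ Q u ∧ P u < Finv η u ∧ Finv η u < Q u ∧
    phiFn η γ a b u = (Efun η γ a u (Q u) - Dfun η γ (P u)) / (Q u - P u)

lemma integrable_max_sub_zero {ζ : Measure ℝ} [IsProbabilityMeasure ζ]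
    (h : Integrable id ζ) (x : ℝ) : Integrable (fun y : ℝ => max (y - x) 0) ζ :=
  (h.sub (integrable_const x)).pos_part

lemma Cfun_antitone {ζ : Measure ℝ} [IsProbabilityMeasure ζ] (h : Integrable id ζ) :
    Antitone (Cfun ζ) := fun x y hxy =>
  integral_mono (integrable_max_sub_zero h y) (integrable_max_sub_zero h x)
    fun z => max_le_max (by linarith) le_rfl

lemma Cfun_le_add_sub {ζ : Measure ℝ} [IsProbabilityMeasure ζ] (h : Integrable id ζ)
    {x y : ℝ} (hxy : x ≤ y) : Cfun ζ x ≤ Cfun ζ y + (y - x) := by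
  have key : ∫ z, max (z - x) 0 ∂ζ ≤ ∫ z, (max (z - y) 0 + (y - x)) ∂ζ := by
    refine integral_mono (integrable_max_sub_zero h x)
      ((integrable_max_sub_zero h y).add (integrable_const _)) fun z => ?_
    apply max_le
    · linarith [le_max_left (z - y) 0]
    · linarith [le_max_right (z - y) 0]
  rw [integral_add (integrable_max_sub_zero h y) (integrable_const _)] at key
  simpa [Cfun] using key

lemma continuous_Cfun {ζ : Measure ℝ} [IsProbabilityMeasure ζ] (h : Integrable id ζ) :
    Continuous (Cfun ζ) := by
  refine (LipschitzWith.of_le_add fun x y => ?_).continuous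
  rw [Real.dist_eq]
  rcases le_total x y with hxy | hxy
  · linarith [Cfun_le_add_sub h hxy, neg_le_abs (x - y)]
  · linarith [Cfun_antitone h hxy, abs_nonneg (x - y)]

lemma measureReal_Ioi_eq {ζ : Measure ℝ} [IsProbabilityMeasure ζ] (w : ℝ) :
    ζ.real (Ioi w) = 1 - (ζ (Iic w)).toReal := by
  rw [← compl_Iic, probReal_compl_eq_one_sub measurableSet_Iic]
  rfl

lemma integral_indicator_Ioi {ζ : Measure ℝ} [IsProbabilityMeasure ζ] (w c : ℝ) :
    ∫ z, (Ioi w).indicator (fun _ => c) z ∂ζ = c * (1 - (ζ (Iic w)).toReal) := by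
  rw [integral_indicator_const _ measurableSet_Ioi, measureReal_Ioi_eq, smul_eq_mul, mul_comm]

/-- The subgradient inequality for `Cfun`. -/
lemma mul_le_Cfun_sub {ζ : Measure ℝ} [IsProbabilityMeasure ζ] (h : Integrable id ζ)
    (y w : ℝ) : (w - y) * (1 - (ζ (Iic w)).toReal) ≤ Cfun ζ y - Cfun ζ w := by
  rw [← integral_indicator_Ioi, Cfun, Cfun,
    ← integral_sub (integrable_max_sub_zero h y) (integrable_max_sub_zero h w)]
  refine integral_mono ((integrable_const _).indicator measurableSet_Ioi)
    ((integrable_max_sub_zero h y).sub (integrable_max_sub_zero h w)) fun z => ?_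
  by_cases hz : w < z
  · simp only [indicator_of_mem (show z ∈ Ioi w from hz)]
    rw [max_eq_left (by linarith : (0 : ℝ) ≤ z - w)]
    linarith [le_max_left (z - y) 0]
  · simp only [indicator_of_notMem (show z ∉ Ioi w from hz)]
    rw [max_eq_right (by linarith : z - w ≤ 0)]
    linarith [le_max_right (z - y) 0]

/-- `Cfun γ` is affine on `[a, b]` when `γ` does not charge `(a, b)`. -/
lemma Cfun_eq_of_measure_Ioo_eq_zero {a b : ℝ} {γ : Measure ℝ} [IsProbabilityMeasure γ]
    (h : Integrable id γ) (hγ : γ (Ioo a b) = 0) {x : ℝ} (hx : x ∈ Icc a b) :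
    Cfun γ x = Cfun γ a - (x - a) * (1 - (γ (Iic a)).toReal) := by
  have key : ∫ z, (max (z - a) 0 - max (z - x) 0) ∂γ
      = ∫ z, (Ioi a).indicator (fun _ => x - a) z ∂γ := by
    refine integral_congr_ae ?_
    have hae : ∀ᵐ z ∂γ, z ∉ Ioo a b := measure_eq_zero_iff_ae_notMem.1 hγ
    filter_upwards [hae] with z hz
    by_cases hza : a < z
    · have hzb : b ≤ z := not_lt.1 fun hlt => hz ⟨hza, hlt⟩
      rw [indicator_of_mem (show z ∈ Ioi a from hza),
        max_eq_left (by linarith), max_eq_left (by linarith [hx.2])]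
      ring
    · rw [indicator_of_notMem (show z ∉ Ioi a from hza),
        max_eq_right (by linarith), max_eq_right (by linarith [hx.1])]
      ring
  rw [integral_indicator_Ioi,
    integral_sub (integrable_max_sub_zero h a) (integrable_max_sub_zero h x)] at key
  simp only [Cfun]
  linarith

section Quantile

variable {a b : ℝ} {η : Measure ℝ} {u : ℝ}

lemma toReal_Iic_eq_zero_of_lt (hη : η (Icc a b)ᶜ = 0) {x : ℝ} (hx : x < a) :
    (η (Iic x)).toReal = 0 := by
  have : η (Iic x) = 0 :=
    measure_mono_null (t := (Icc a b)ᶜ)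
      (fun z hz hz' => absurd (hz'.1.trans hz) (not_le.2 hx)) hη
  simp [this]

lemma toReal_Iic_eq_one [IsProbabilityMeasure η] (hη : η (Icc a b)ᶜ = 0) : (η (Iic b)).toReal = 1 := by
  have h0 : η (Ioi b) = 0 :=
    measure_mono_null (t := (Icc a b)ᶜ) (fun z hz hz' => absurd hz'.2 (not_le.2 hz)) hη
  have h1 := measureReal_Ioi_eq (ζ := η) b
  rw [measureReal_def, h0, ENNReal.toReal_zero] at h1
  linarith

lemma mem_lowerBounds_quantile (hη : η (Icc a b)ᶜ = 0) (hu : u ∈ Ioo (0 : ℝ) 1) :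
    a ∈ lowerBounds {x : ℝ | u ≤ (η (Iic x)).toReal} := by
  intro x hx
  by_contra! hlt
  rw [mem_ofPred_eq, toReal_Iic_eq_zero_of_lt hη hlt] at hx
  linarith [hu.1]

lemma mem_quantile_set [IsProbabilityMeasure η] (hη : η (Icc a b)ᶜ = 0) (hu : u ∈ Ioo (0 : ℝ) 1) :
    b ∈ {x : ℝ | u ≤ (η (Iic x)).toReal} := by
  rw [mem_ofPred_eq, toReal_Iic_eq_one hη]
  exact hu.2.le

lemma Finv_mem_Icc [IsProbabilityMeasure η] (hη : η (Icc a b)ᶜ = 0) (hu : u ∈ Ioo (0 : ℝ) 1) :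
    Finv η u ∈ Icc a b :=
  ⟨le_csInf ⟨b, mem_quantile_set hη hu⟩ (mem_lowerBounds_quantile hη hu),
    csInf_le ⟨a, mem_lowerBounds_quantile hη hu⟩ (mem_quantile_set hη hu)⟩

lemma toReal_Iic_lt_of_lt_Finv (hη : η (Icc a b)ᶜ = 0) (hu : u ∈ Ioo (0 : ℝ) 1) {w : ℝ}
    (hw : w < Finv η u) : (η (Iic w)).toReal < u := by
  by_contra! h
  exact absurd (csInf_le ⟨a, mem_lowerBounds_quantile hη hu⟩ h) (not_le.2 hw)

lemma le_toReal_Iic_Finv [IsProbabilityMeasure η] (hη : η (Icc a b)ᶜ = 0) (hu : u ∈ Ioo (0 : ℝ) 1) :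
    u ≤ (η (Iic (Finv η u))).toReal := by
  have hcont : ContinuousWithinAt (cdf η) (Ioi (Finv η u)) (Finv η u) :=
    ((cdf η).right_continuous _).mono Ioi_subset_Ici_self
  have hle : u ≤ cdf η (Finv η u) := by
    refine ge_of_tendsto hcont ?_
    filter_upwards [self_mem_nhdsWithin] with x hx
    obtain ⟨w, hw, hwx⟩ := exists_lt_of_csInf_lt ⟨b, mem_quantile_set hη hu⟩ hx
    have hw' : u ≤ cdf η w := by rw [cdf_eq_real]; exact hw
    exact hw'.trans (monotone_cdf η hwx.le)
  rwa [cdf_eq_real] at hle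

/-- At the `u`-quantile, `u - 1` is a subgradient of `Cfun η`. -/
lemma mul_le_Cfun_sub_Finv [IsProbabilityMeasure η] (hη1 : Integrable id η)
    (hη : η (Icc a b)ᶜ = 0) (hu : u ∈ Ioo (0 : ℝ) 1) (y : ℝ) :
    (Finv η u - y) * (1 - u) ≤ Cfun η y - Cfun η (Finv η u) := by
  rcases le_or_gt (Finv η u) y with hy | hy
  · have h1 := mul_le_Cfun_sub hη1 y (Finv η u)
    nlinarith [le_toReal_Iic_Finv hη hu]
  · have hlim : Filter.Tendsto (fun w => (w - y) * (1 - u)) (nhdsWithin (Finv η u) (Iio (Finv η u)))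
        (nhds ((Finv η u - y) * (1 - u))) :=
      (Continuous.tendsto (by fun_prop) _).mono_left nhdsWithin_le_nhds
    refine le_of_tendsto hlim ?_
    filter_upwards [Ioo_mem_nhdsLT hy] with w hw
    have h1 := mul_le_Cfun_sub hη1 y w
    have h2 := Cfun_antitone hη1 hw.2.le
    nlinarith [toReal_Iic_lt_of_lt_Finv hη hu hw.2, hw.1]

end Quantile

lemma bddAbove_phiFn_set {a b : ℝ} {η γ : Measure ℝ} {u : ℝ} (hab : a < b)
    (hC : ∀ x : ℝ, Cfun η x ≤ Cfun γ x) :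
    BddAbove {r : ℝ | ∃ pp qq : ℝ, pp ≤ a ∧ b ≤ qq ∧ pp < Finv η u ∧ Finv η u < qq ∧
      r = (Efun η γ a u qq - Dfun η γ pp) / (qq - pp)} := by
  have hD : ∀ x, 0 ≤ Dfun η γ x := fun x => sub_nonneg.2 (hC x)
  refine ⟨Dfun η γ (Finv η u) / (b - a) + |(γ (Iic a)).toReal - u|, ?_⟩
  rintro r ⟨p, q, hp, hq, hpm, hmq, rfl⟩
  have hba : 0 < b - a := sub_pos.2 hab
  rw [div_le_iff₀ (by linarith), Efun, add_mul]
  have h1 : Dfun η γ (Finv η u) ≤ Dfun η γ (Finv η u) / (b - a) * (q - p) :=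
    calc Dfun η γ (Finv η u) = Dfun η γ (Finv η u) / (b - a) * (b - a) := by field_simp
      _ ≤ _ := mul_le_mul_of_nonneg_left (by linarith) (div_nonneg (hD _) hba.le)
  have h2 : (q - Finv η u) * ((γ (Iic a)).toReal - u) ≤ |(γ (Iic a)).toReal - u| * (q - p) :=
    calc _ ≤ (q - Finv η u) * |(γ (Iic a)).toReal - u| :=
          mul_le_mul_of_nonneg_left (le_abs_self _) (by linarith)
      _ ≤ _ := by rw [mul_comm]; exact mul_le_mul_of_nonneg_left (by linarith) (abs_nonneg _)
  linarith [hD p, hD q]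

section Potential

variable {a b : ℝ} {η γ : Measure ℝ} [IsProbabilityMeasure η] [IsProbabilityMeasure γ] {u : ℝ}

/-- On `[a, b]`, `Dfun η γ` lies below its tangent of slope `γ_a - u` at the `u`-quantile. -/
lemma Dfun_le_tangent (hη1 : Integrable id η) (hγ1 : Integrable id γ)
    (hη : η (Icc a b)ᶜ = 0) (hγ : γ (Ioo a b) = 0) (hu : u ∈ Ioo (0 : ℝ) 1)
    {y : ℝ} (hy : y ∈ Icc a b) :
    Dfun η γ y ≤ Dfun η γ (Finv η u) + (y - Finv η u) * ((γ (Iic a)).toReal - u) := by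
  have h1 := mul_le_Cfun_sub_Finv hη1 hη hu y
  have h2 := Cfun_eq_of_measure_Ioo_eq_zero hγ1 hγ hy
  have h3 := Cfun_eq_of_measure_Ioo_eq_zero hγ1 hγ (Finv_mem_Icc hη hu)
  simp only [Dfun]
  linarith

/-- The quotient is at most `phiFn` for every `p ≤ a` and `b ≤ q`, including boundary cases
where `p` or `q` equals the quantile. -/
lemma div_le_phiFn (hab : a < b) (hη1 : Integrable id η) (hγ1 : Integrable id γ)
    (hη : η (Icc a b)ᶜ = 0) (hC : ∀ x : ℝ, Cfun η x ≤ Cfun γ x) (hu : u ∈ Ioo (0 : ℝ) 1)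
    {p q : ℝ} (hp : p ≤ a) (hq : b ≤ q) :
    (Efun η γ a u q - Dfun η γ p) / (q - p) ≤ phiFn η γ a b u := by
  have hD : Continuous (Dfun η γ) := (continuous_Cfun hγ1).sub (continuous_Cfun hη1)
  have hE : Continuous (Efun η γ a u) := by unfold Efun; fun_prop
  have hlim : ContinuousAt (fun ε : ℝ =>
      (Efun η γ a u (q + ε) - Dfun η γ (p - ε)) / ((q + ε) - (p - ε))) 0 := by
    refine ContinuousAt.div (by fun_prop) (by fun_prop) ?_
    simp only [add_zero, sub_zero]
    linarith
  have hlim' := hlim.tendsto.mono_left (nhdsWithin_le_nhds (s := Ioi (0 : ℝ)))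
  simp only [add_zero, sub_zero] at hlim'
  refine le_of_tendsto hlim' ?_
  filter_upwards [self_mem_nhdsWithin] with ε hε
  have hε' : 0 < ε := hε
  have hm := Finv_mem_Icc hη hu
  exact le_csSup (bddAbove_phiFn_set hab hC) ⟨p - ε, q + ε, by linarith, by linarith,
    by linarith [hm.1], by linarith [hm.2], rfl⟩

end Potential

theorem stmt3 (a b : ℝ) (hab : a < b) (η γ : Measure ℝ)
    [IsProbabilityMeasure η] [IsProbabilityMeasure γ]
    (hη1 : Integrable id η) (hγ1 : Integrable id γ)
    (hmean : ∫ x, x ∂η = ∫ x, x ∂γ)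
    (hsupη : η (Icc a b)ᶜ = 0) (hsupγ : γ (Ioo a b) = 0)
    (hC : ∀ x : ℝ, Cfun η x ≤ Cfun γ x)
    (P Q : ℝ → ℝ) (hPQ : AttainsSup η γ a b P Q) :
    ∀ u uh : ℝ, u ∈ Ioo (0 : ℝ) 1 → uh ∈ Ioo (0 : ℝ) 1 → u < uh →
      phiFn η γ a b uh ≤ phiFn η γ a b u ∧
      phiFn η γ a b u + (u - uh) ≤ phiFn η γ a b uh := by
  intro u v hu hv huv
  have hm := Finv_mem_Icc hsupη hu
  have hn := Finv_mem_Icc hsupη hv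
  constructor
  · obtain ⟨hp, hq, -, -, hphi⟩ := hPQ v hv
    rw [hphi]
    refine le_trans ?_ (div_le_phiFn hab hη1 hγ1 hsupη hC hu hp hq)
    refine div_le_div_of_nonneg_right ?_ (by linarith)
    have ht := Dfun_le_tangent hη1 hγ1 hsupη hsupγ hu hn
    simp only [Efun]
    nlinarith [hn.2]
  · obtain ⟨hp, hq, -, -, hphi⟩ := hPQ u hu
    rw [hphi]
    refine le_trans ?_ (div_le_phiFn hab hη1 hγ1 hsupη hC hv hp hq)
    have hpos : 0 < Q u - P u := by linarith
    rw [div_add' _ _ _ hpos.ne']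
    refine div_le_div_of_nonneg_right ?_ hpos.le
    have ht := Dfun_le_tangent hη1 hγ1 hsupη hsupγ hv hm
    simp only [Efun]
    nlinarith [hm.1]
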